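/- For every n ≥ 1, the following two subsets of ℝ^n coincide (this common polytope realizes the weak rectangulotope WRP(n)): (i) the convex hull of the points Σ_{i∈[n]} (h^{T(R)}_i·v^{T(R)}_i − h^{S(R)}_i·v^{S(R)}_i)·e_i, taken over all generic rectangulations R of size n (this point depends only on the weak equivalence class of R, so the points are indexed by weak rectangulations of size n); (ii) the set of x ∈ ℝ^n with Σ_{i∈[n]} x_i = 0 and, for every nonempty proper subset X ⊊ [n], Σ_{i∈X} x_i ≤ #{I interval of [n] : I ⊄ X and I ⊄ [n]∖X}. -/

import Mathlib

open Classical Pointwise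

noncomputable section

/-- An interval of `[n]`: a nonempty set of consecutive integers. -/
def IsInterval {n : ℕ} (I : Finset (Fin n)) : Prop :=
  I.Nonempty ∧ ∀ a b c : Fin n, a ∈ I → c ∈ I → a ≤ b → b ≤ c → b ∈ I

/-- Two intervals `I`, `J` of `[n]` are consecutive if `max I = min J − 1`. -/
def ConsecIntervals {n : ℕ} (I J : Finset (Fin n)) : Prop :=
  ∃ (hI : IsInterval I) (hJ : IsInterval J),
    (I.max' hI.1 : ℕ) + 1 = (J.min' hJ.1 : ℕ)

/-- The standard basis vector `e i` of `ℝ^n`. -/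
def stdVec (n : ℕ) (i : Fin n) : Fin n → ℝ := fun k => if k = i then 1 else 0

/-- `f_≍(X)`: number of intervals of `[n]` contained neither in `X` nor in its complement. -/
def fWeak (n : ℕ) (X : Finset (Fin n)) : ℕ :=
  {I : Finset (Fin n) | IsInterval I ∧ ¬ I ⊆ X ∧ ¬ I ⊆ Xᶜ}.ncard

/-- `f_⥮(X)`. -/
def fStrong (n : ℕ) (X : Finset (Fin n)) : ℕ :=
  {p : Finset (Fin n) × Finset (Fin n) |
      ConsecIntervals p.1 p.2 ∧ ¬ p.1 ⊆ X ∧ ¬ p.2 ⊆ Xᶜ}.ncard +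
  {p : Finset (Fin n) × Finset (Fin n) |
      ConsecIntervals p.1 p.2 ∧ ¬ p.1 ⊆ Xᶜ ∧ ¬ p.2 ⊆ X}.ncard


/-- A rectangulation of size `n`: a decomposition of the unit square into `n`
axis-parallel rectangles with pairwise disjoint interiors.  Rectangle `i` is
`[xl i, xr i] × [yb i, yt i]`. -/
structure Rectangulation (n : ℕ) where
  xl : Fin n → ℝ
  xr : Fin n → ℝ
  yb : Fin n → ℝ
  yt : Fin n → ℝ
  lt_x : ∀ i, xl i < xr i
  lt_y : ∀ i, yb i < yt i
  xl_nonneg : ∀ i, 0 ≤ xl i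
  xr_le_one : ∀ i, xr i ≤ 1
  yb_nonneg : ∀ i, 0 ≤ yb i
  yt_le_one : ∀ i, yt i ≤ 1
  interiors_disjoint : ∀ i j, i ≠ j →
    ¬ ∃ p : ℝ × ℝ, (xl i < p.1 ∧ p.1 < xr i ∧ yb i < p.2 ∧ p.2 < yt i) ∧
      (xl j < p.1 ∧ p.1 < xr j ∧ yb j < p.2 ∧ p.2 < yt j)
  cover : ∀ p : ℝ × ℝ, 0 ≤ p.1 → p.1 ≤ 1 → 0 ≤ p.2 → p.2 ≤ 1 →
    ∃ i, xl i ≤ p.1 ∧ p.1 ≤ xr i ∧ yb i ≤ p.2 ∧ p.2 ≤ yt i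

namespace Rectangulation

variable {n : ℕ} (R : Rectangulation n)

/-- `p` is a corner (vertex) of rectangle `i`. -/
def IsCorner (i : Fin n) (p : ℝ × ℝ) : Prop :=
  (p.1 = R.xl i ∨ p.1 = R.xr i) ∧ (p.2 = R.yb i ∨ p.2 = R.yt i)

/-- `R` is generic: no four rectangles have a common vertex. -/
def Generic : Prop :=
  ¬ ∃ (p : ℝ × ℝ) (i j k l : Fin n),
    i ≠ j ∧ i ≠ k ∧ i ≠ l ∧ j ≠ k ∧ j ≠ l ∧ k ≠ l ∧
    R.IsCorner i p ∧ R.IsCorner j p ∧ R.IsCorner k p ∧ R.IsCorner l p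

/-- `p` lies on a horizontal edge of some rectangle of `R`. -/
def OnHorizEdge (p : ℝ × ℝ) : Prop :=
  ∃ i, (p.2 = R.yb i ∨ p.2 = R.yt i) ∧ R.xl i ≤ p.1 ∧ p.1 ≤ R.xr i

/-- `p` lies on a vertical edge of some rectangle of `R`. -/
def OnVertEdge (p : ℝ × ℝ) : Prop :=
  ∃ i, (p.1 = R.xl i ∨ p.1 = R.xr i) ∧ R.yb i ≤ p.2 ∧ p.2 ≤ R.yt i

/-- The horizontal edges `[a₁,b₁] × {y}` and `[a₂,b₂] × {y}` lie on the same
(horizontal) segment of `R`: `y` is not on the boundary of the square and every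
point between the two edges lies on a horizontal edge of a rectangle. -/
def SameHSeg (y a₁ b₁ a₂ b₂ : ℝ) : Prop :=
  0 < y ∧ y < 1 ∧ ∀ x : ℝ, min a₁ a₂ ≤ x → x ≤ max b₁ b₂ → R.OnHorizEdge (x, y)

/-- The vertical edges `{x} × [a₁,b₁]` and `{x} × [a₂,b₂]` lie on the same
(vertical) segment of `R`. -/
def SameVSeg (x a₁ b₁ a₂ b₂ : ℝ) : Prop :=
  0 < x ∧ x < 1 ∧ ∀ y : ℝ, min a₁ a₂ ≤ y → y ≤ max b₁ b₂ → R.OnVertEdge (x, y)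

/-- Rectangle `i` is directly above `j`: the bottom edge of `i` lies on the same
segment as the top edge of `j`. -/
def DirAbove (i j : Fin n) : Prop :=
  R.yb i = R.yt j ∧ R.SameHSeg (R.yb i) (R.xl i) (R.xr i) (R.xl j) (R.xr j)

/-- Rectangle `i` is above `j`. -/
def Above : Fin n → Fin n → Prop := Relation.TransGen R.DirAbove

/-- Rectangle `i` is directly on the right of `j`: the left edge of `i` lies on
the same segment as the right edge of `j`. -/
def DirRightOf (i j : Fin n) : Prop :=
  R.xl i = R.xr j ∧ R.SameVSeg (R.xl i) (R.yb i) (R.yt i) (R.yb j) (R.yt j)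

/-- Rectangle `i` is on the right of `j`. -/
def RightOf : Fin n → Fin n → Prop := Relation.TransGen R.DirRightOf

/-- The inorder (NW–SE) order on the rectangles: the transitive closure of the
union of the below and right-of relations. -/
def InorderLT : Fin n → Fin n → Prop :=
  Relation.TransGen (fun i j => R.RightOf j i ∨ R.Above i j)

/-- The rectangles of `R` are labeled `1, …, n` in inorder. -/
def InorderLabeled : Prop := ∀ i j : Fin n, R.InorderLT i j ↔ i < j

/-- `q` is the parent of `r` via a horizontal edge in the source tree `S(R)`:
the bottom-right corner of `q` is the source (bottom-left corner) of `r`. -/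
def SEdgeH (q r : Fin n) : Prop := R.xr q = R.xl r ∧ R.yb q = R.yb r

/-- `q` is the parent of `r` via a vertical edge in the source tree `S(R)`:
the top-left corner of `q` is the source (bottom-left corner) of `r`. -/
def SEdgeV (q r : Fin n) : Prop := R.xl q = R.xl r ∧ R.yt q = R.yb r

/-- `q` is the parent of `r` via a horizontal edge in the target tree `T(R)`:
the top-left corner of `q` is the target (top-right corner) of `r`. -/
def TEdgeH (r q : Fin n) : Prop := R.xl q = R.xr r ∧ R.yt q = R.yt r

/-- `q` is the parent of `r` via a vertical edge in the target tree `T(R)`: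
the bottom-right corner of `q` is the target (top-right corner) of `r`. -/
def TEdgeV (r q : Fin n) : Prop := R.xr q = R.xr r ∧ R.yb q = R.yt r

/-- `a` is a descendant of `q` (or `a = q`) in the source tree. -/
def SReach : Fin n → Fin n → Prop :=
  Relation.ReflTransGen (fun a b => R.SEdgeH a b ∨ R.SEdgeV a b)

/-- `q` is an ancestor of `a` (or `a = q`) in the target tree. -/
def TReach : Fin n → Fin n → Prop :=
  Relation.ReflTransGen (fun a b => R.TEdgeH a b ∨ R.TEdgeV a b)

/-- `a` is a node of the vertical subtree of `i` in the target tree. -/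
def VSubT (i a : Fin n) : Prop := ∃ r, R.TEdgeV r i ∧ R.TReach a r

/-- `a` is a node of the horizontal subtree of `i` in the target tree. -/
def HSubT (i a : Fin n) : Prop := ∃ r, R.TEdgeH r i ∧ R.TReach a r

/-- `a` is a node of the vertical subtree of `i` in the source tree. -/
def VSubS (i a : Fin n) : Prop := ∃ r, R.SEdgeV i r ∧ R.SReach r a

/-- `a` is a node of the horizontal subtree of `i` in the source tree. -/
def HSubS (i a : Fin n) : Prop := ∃ r, R.SEdgeH i r ∧ R.SReach r a

/-- `h^T_i`: the number of leaves of the horizontal subtree of `i` in the target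
tree (a binary tree with `k` nodes has `k + 1` leaves). -/
def hT (i : Fin n) : ℕ := 1 + {a | R.HSubT i a}.ncard

/-- `v^T_i`. -/
def vT (i : Fin n) : ℕ := 1 + {a | R.VSubT i a}.ncard

/-- `h^S_i`. -/
def hS (i : Fin n) : ℕ := 1 + {a | R.HSubS i a}.ncard

/-- `v^S_i`. -/
def vS (i : Fin n) : ℕ := 1 + {a | R.VSubS i a}.ncard

/-- The node `a` of the target tree carries a vertical leaf. -/
def TVLeaf (a : Fin n) : Prop := ¬ ∃ r, R.TEdgeV r a

/-- The node `a` of the target tree carries a horizontal leaf. -/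
def THLeaf (a : Fin n) : Prop := ¬ ∃ r, R.TEdgeH r a

/-- The node `b` of the source tree carries a vertical leaf. -/
def SVLeaf (b : Fin n) : Prop := ¬ ∃ r, R.SEdgeV b r

/-- The node `b` of the source tree carries a horizontal leaf. -/
def SHLeaf (b : Fin n) : Prop := ¬ ∃ r, R.SEdgeH b r

/-- The vertical leaf of `T(R)` at `a` and the vertical leaf of `S(R)` at `b`
are common leaves: the edges to their parents lie on the same (vertical)
segment of `R` (the one supporting the right edge of `a` and the left edge of `b`). -/
def CommonVLeaf (a b : Fin n) : Prop :=
  R.TVLeaf a ∧ R.SVLeaf b ∧ R.xr a = R.xl b ∧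
    R.SameVSeg (R.xr a) (R.yb a) (R.yt a) (R.yb b) (R.yt b)

/-- The horizontal leaf of `T(R)` at `a` and the horizontal leaf of `S(R)` at `b`
are common leaves: the edges to their parents lie on the same (horizontal)
segment of `R` (supporting the top edge of `a` and the bottom edge of `b`). -/
def CommonHLeaf (a b : Fin n) : Prop :=
  R.THLeaf a ∧ R.SHLeaf b ∧ R.yt a = R.yb b ∧
    R.SameHSeg (R.yt a) (R.xl a) (R.xr a) (R.xl b) (R.xr b)

/-- `cv^{T,S}_{i,j}`: the number of common leaves of the vertical subtree of `i`
in `T(R)` and the vertical subtree of `j` in `S(R)`. -/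
def cv (i j : Fin n) : ℕ :=
  {p : Fin n × Fin n |
    (R.CommonVLeaf p.1 p.2 ∧ (R.VSubT i p.1 ∨ p.1 = i) ∧ (R.VSubS j p.2 ∨ p.2 = j)) ∨
    (R.CommonHLeaf p.1 p.2 ∧ R.VSubT i p.1 ∧ R.VSubS j p.2)}.ncard

/-- `ch^{S,T}_{i,j}`: the number of common leaves of the horizontal subtree of `i`
in `S(R)` and the horizontal subtree of `j` in `T(R)`. -/
def ch (i j : Fin n) : ℕ :=
  {p : Fin n × Fin n |
    (R.CommonHLeaf p.2 p.1 ∧ (R.HSubS i p.1 ∨ p.1 = i) ∧ (R.HSubT j p.2 ∨ p.2 = j)) ∨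
    (R.CommonVLeaf p.2 p.1 ∧ R.HSubS i p.1 ∧ R.HSubT j p.2)}.ncard

/-- The weak poset `≺_w^R`: the transitive closure of the union of the partial
orders given by the edges of `S(R)` and of `T(R)`, horizontal edges oriented
left to right and vertical edges bottom to top. -/
def PrecW : Fin n → Fin n → Prop :=
  Relation.TransGen (fun a b => R.SEdgeH a b ∨ R.SEdgeV a b ∨ R.TEdgeH a b ∨ R.TEdgeV a b)

/-- One step of the adjacency relation: `r_i` and `r_j` share part of a segment
of `R`, and `r_i` lies to the left of or below `r_j`. -/
def AdjStep (i j : Fin n) : Prop :=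
  (R.xr i = R.xl j ∧ max (R.yb i) (R.yb j) < min (R.yt i) (R.yt j)) ∨
  (R.yt i = R.yb j ∧ max (R.xl i) (R.xl j) < min (R.xr i) (R.xr j))

/-- The special relation `i ◁◁ j`. -/
def Special (i j : Fin n) : Prop :=
  (R.xr j = R.xl i ∧ R.SameVSeg (R.xl i) (R.yb j) (R.yt j) (R.yb i) (R.yt i) ∧
    R.yt i < R.yb j) ∨
  (R.yt j = R.yb i ∧ R.SameHSeg (R.yb i) (R.xl j) (R.xr j) (R.xl i) (R.xr i) ∧
    R.xr i < R.xl j)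

/-- The strong poset `≺_s^R`: the transitive closure of the union of the
adjacency relation and the special relation. -/
def PrecS : Fin n → Fin n → Prop :=
  Relation.TransGen (fun a b => R.AdjStep a b ∨ R.Special a b)

/-- The vertical pattern `i‖j`: `r_i` and `r_j` share a vertical segment
containing the right edge of `r_i` and the left edge of `r_j`, and the bottom
edge of `r_i` is below the top edge of `r_j`. -/
def VertPattern (i j : Fin n) : Prop :=
  R.xr i = R.xl j ∧ R.SameVSeg (R.xr i) (R.yb i) (R.yt i) (R.yb j) (R.yt j) ∧
    R.yb i < R.yt j

/-- The horizontal pattern `i⦀j`: `r_i` and `r_j` share a horizontal segment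
containing the bottom edge of `r_i` and the top edge of `r_j`, and the right
edge of `r_i` is to the right of the left edge of `r_j`. -/
def HorPattern (i j : Fin n) : Prop :=
  R.yb i = R.yt j ∧ R.SameHSeg (R.yb i) (R.xl i) (R.xr i) (R.xl j) (R.xr j) ∧
    R.xl j < R.xr i

end Rectangulation



/-! ### Abstract binary search trees -/

section Tree

variable {n : ℕ}

/-- The intervals of `[n]` as a finset. -/
def intv (n : ℕ) : Finset (Finset (Fin n)) := Finset.univ.filter IsInterval

theorem mem_intv (I : Finset (Fin n)) : I ∈ intv n ↔ IsInterval I := by simp [intv]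

theorem isInterval_Icc {a b : Fin n} (h : a ≤ b) : IsInterval (Finset.Icc a b) := by
  refine ⟨⟨a, by simp [h]⟩, ?_⟩
  intro x y z hx hz h1 h2
  simp only [Finset.mem_Icc] at *
  exact ⟨hx.1.trans h1, h2.trans hz.2⟩

theorem IsInterval.eq_Icc {I : Finset (Fin n)} (h : IsInterval I) :
    I = Finset.Icc (I.min' h.1) (I.max' h.1) := by
  ext x
  rw [Finset.mem_Icc]
  constructor
  · intro hx
    exact ⟨Finset.min'_le _ _ hx, Finset.le_max' _ _ hx⟩
  · rintro ⟨h1, h2⟩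
    exact h.2 _ _ _ (Finset.min'_mem _ _) (Finset.max'_mem _ _) h1 h2

theorem tree_top (eL eR : Fin n → Fin n → Prop) (φ : Fin n → ℝ)
    (hφL : ∀ r q, eL r q → φ r < φ q) (hφR : ∀ r q, eR r q → φ r < φ q)
    (uL : ∀ r r' q, eL r q → eL r' q → r = r') (uR : ∀ r r' q, eR r q → eR r' q → r = r')
    (root : ∃ ρ, ∀ a, Relation.ReflTransGen (fun a b => eL a b ∨ eR a b) a ρ)
    (DL : ∀ a r q, eL r q → Relation.ReflTransGen (fun a b => eL a b ∨ eR a b) a r → a < q)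
    (DR : ∀ a r q, eR r q → Relation.ReflTransGen (fun a b => eL a b ∨ eR a b) a r → q < a) :
    ∃ top : Finset (Fin n) → Fin n,
      (∀ I, IsInterval I → top I ∈ I ∧
        ∀ a ∈ I, Relation.ReflTransGen (fun a b => eL a b ∨ eR a b) a (top I)) ∧
      ∀ i, (1 + {a | ∃ r, eL r i ∧ Relation.ReflTransGen (fun a b => eL a b ∨ eR a b) a r}.ncard) *
        (1 + {a | ∃ r, eR r i ∧ Relation.ReflTransGen (fun a b => eL a b ∨ eR a b) a r}.ncard) =
        ((intv n).filter (fun I => top I = i)).card := by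
  set Reach := Relation.ReflTransGen (fun a b => eL a b ∨ eR a b) with hReach
  have mono : ∀ a b, Reach a b → φ a ≤ φ b := by
    intro a b h
    induction h with
    | refl => exact le_rfl
    | tail _ h ih =>
      rcases h with h | h
      · exact ih.trans (hφL _ _ h).le
      · exact ih.trans (hφR _ _ h).le
  have split : ∀ a c, Reach a c → a = c ∨ (∃ r, eL r c ∧ Reach a r) ∨ (∃ r, eR r c ∧ Reach a r) := by
    intro a c h
    rcases Relation.ReflTransGen.cases_tail h with h | ⟨r, h1, h2⟩
    · exact Or.inl h.symm
    · rcases h2 with h2 | h2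
      · exact Or.inr (Or.inl ⟨r, h2, h1⟩)
      · exact Or.inr (Or.inr ⟨r, h2, h1⟩)
  have anti : ∀ a b, Reach a b → Reach b a → a = b := by
    intro a b h1 h2
    have e := mono _ _ h2
    rcases split _ _ h1 with h | ⟨r, h, h'⟩ | ⟨r, h, h'⟩
    · exact h
    · have := hφL _ _ h
      have := mono _ _ h'
      linarith
    · have := hφR _ _ h
      have := mono _ _ h'
      linarith
  have toL : ∀ a r c, eL r c → Reach a r → Reach a c := fun a r c h h' =>
    h'.tail (Or.inl h)
  have toR : ∀ a r c, eR r c → Reach a r → Reach a c := fun a r c h h' =>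
    h'.tail (Or.inr h)
  -- lowest common ancestors
  have lca : ∀ a b : Fin n, a ≤ b → ∃ c, Reach a c ∧ Reach b c ∧ a ≤ c ∧ c ≤ b ∧
      ∀ d, Reach a d → Reach b d → φ c ≤ φ d := by
    intro a b hab
    obtain ⟨ρ, hρ⟩ := root
    obtain ⟨c, hc, hmin⟩ := Finset.exists_min_image
      (Finset.univ.filter (fun c => Reach a c ∧ Reach b c)) φ ⟨ρ, by simp [hρ]⟩
    simp only [Finset.mem_filter, Finset.mem_univ, true_and] at hc hmin
    refine ⟨c, hc.1, hc.2, ?_, ?_, fun d h1 h2 => hmin d ⟨h1, h2⟩⟩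
    · by_contra hlt
      push Not at hlt
      rcases split _ _ hc.1 with h | ⟨r, h, h'⟩ | ⟨r, h, h'⟩
      · exact absurd h hlt.ne'
      · exact absurd (DL _ _ _ h h') (not_lt.2 hlt.le)
      · rcases split _ _ hc.2 with g | ⟨s, g, g'⟩ | ⟨s, g, g'⟩
        · subst g; exact absurd hlt (not_lt.2 hab)
        · exact absurd (DL _ _ _ g g') (not_lt.2 (hlt.le.trans hab))
        · have := uR _ _ _ h g
          subst this
          have := hmin r ⟨h', g'⟩
          have := hφR _ _ h
          linarith
    · by_contra hlt
      push Not at hlt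
      rcases split _ _ hc.2 with h | ⟨r, h, h'⟩ | ⟨r, h, h'⟩
      · exact absurd h hlt.ne
      · rcases split _ _ hc.1 with g | ⟨s, g, g'⟩ | ⟨s, g, g'⟩
        · subst g; exact absurd hlt (not_lt.2 hab)
        · have := uL _ _ _ h g
          subst this
          have := hmin r ⟨g', h'⟩
          have := hφL _ _ h
          linarith
        · exact absurd (DR _ _ _ g g') (not_lt.2 (hab.trans hlt.le))
      · exact absurd (DR _ _ _ h h') (not_lt.2 hlt.le)
  -- subtrees are intervals
  have convL : ∀ a k i : Fin n, Reach a i → a ≤ k → k ≤ i → Reach k i := by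
    intro a k i hai hak hki
    obtain ⟨c, h1, h2, h3, h4, _⟩ := lca k i hki
    rcases split _ _ h2 with h | ⟨r, h, h'⟩ | ⟨r, h, h'⟩
    · rw [h]; exact h1
    · exact absurd (DL _ _ _ h h') (not_lt.2 h4)
    · exact absurd (DR _ _ _ h (hai.trans h')) (not_lt.2 (hak.trans h3))
  have convR : ∀ a k i : Fin n, Reach a i → i ≤ k → k ≤ a → Reach k i := by
    intro a k i hai hik hka
    obtain ⟨c, h1, h2, h3, h4, _⟩ := lca i k hik
    rcases split _ _ h1 with h | ⟨r, h, h'⟩ | ⟨r, h, h'⟩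
    · rw [h]; exact h2
    · exact absurd (DL _ _ _ h (hai.trans h')) (not_lt.2 (h4.trans hka))
    · exact absurd (DR _ _ _ h h') (not_lt.2 h3)
  have ex : ∀ I : Finset (Fin n), IsInterval I → ∃ t, t ∈ I ∧ ∀ a ∈ I, Reach a t := by
    intro I hI
    obtain ⟨c, h1, h2, h3, h4, _⟩ := lca (I.min' hI.1) (I.max' hI.1)
      (Finset.min'_le _ _ (Finset.max'_mem _ _))
    refine ⟨c, hI.2 _ _ _ (Finset.min'_mem _ _) (Finset.max'_mem _ _) h3 h4, ?_⟩
    intro a ha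
    rcases le_total a c with h | h
    · exact convL _ _ _ h1 (Finset.min'_le _ _ ha) h
    · exact convR _ _ _ h2 h (Finset.le_max' _ _ ha)
  obtain ⟨ρ, hρ⟩ := root
  choose top htop using (fun I => (by
    by_cases hI : IsInterval I
    · obtain ⟨t, ht⟩ := ex I hI
      exact ⟨t, fun _ => ht⟩
    · exact ⟨ρ, fun h => absurd h hI⟩ :
      ∃ t, IsInterval I → t ∈ I ∧ ∀ a ∈ I, Reach a t))
  refine ⟨top, fun I hI => htop I hI, ?_⟩
  intro i
  have e1 : 1 + {a | ∃ r, eL r i ∧ Reach a r}.ncard =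
      (Finset.univ.filter (fun a => a ≤ i ∧ Reach a i)).card := by
    have : Finset.univ.filter (fun a => a ≤ i ∧ Reach a i) =
        insert i (Finset.univ.filter (fun a => ∃ r, eL r i ∧ Reach a r)) := by
      ext a
      simp only [Finset.mem_filter, Finset.mem_univ, true_and, Finset.mem_insert]
      constructor
      · rintro ⟨h1, h2⟩
        rcases split _ _ h2 with h | h | ⟨r, h, h'⟩
        · exact Or.inl h
        · exact Or.inr h
        · exact absurd (DR _ _ _ h h') (not_lt.2 h1)
      · rintro (h | ⟨r, h, h'⟩)
        · subst h; exact ⟨le_rfl, Relation.ReflTransGen.refl⟩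
        · exact ⟨(DL _ _ _ h h').le, toL _ _ _ h h'⟩
    rw [this, Finset.card_insert_of_notMem, add_comm, ← Set.ncard_coe_finset]
    · simp
    · simp only [Finset.mem_filter, Finset.mem_univ, true_and]
      rintro ⟨r, h, h'⟩
      exact lt_irrefl _ (DL _ _ _ h h')
  have e2 : 1 + {a | ∃ r, eR r i ∧ Reach a r}.ncard =
      (Finset.univ.filter (fun a => i ≤ a ∧ Reach a i)).card := by
    have : Finset.univ.filter (fun a => i ≤ a ∧ Reach a i) =
        insert i (Finset.univ.filter (fun a => ∃ r, eR r i ∧ Reach a r)) := by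
      ext a
      simp only [Finset.mem_filter, Finset.mem_univ, true_and, Finset.mem_insert]
      constructor
      · rintro ⟨h1, h2⟩
        rcases split _ _ h2 with h | ⟨r, h, h'⟩ | h
        · exact Or.inl h
        · exact absurd (DL _ _ _ h h') (not_lt.2 h1)
        · exact Or.inr h
      · rintro (h | ⟨r, h, h'⟩)
        · subst h; exact ⟨le_rfl, Relation.ReflTransGen.refl⟩
        · exact ⟨(DR _ _ _ h h').le, toR _ _ _ h h'⟩
    rw [this, Finset.card_insert_of_notMem, add_comm, ← Set.ncard_coe_finset]
    · simp
    · simp only [Finset.mem_filter, Finset.mem_univ, true_and]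
      rintro ⟨r, h, h'⟩
      exact lt_irrefl _ (DR _ _ _ h h')
  rw [e1, e2, ← Finset.card_product]
  refine Finset.card_bij (fun p _ => Finset.Icc p.1 p.2) ?_ ?_ ?_
  · rintro ⟨a, b⟩ hp
    simp only [Finset.mem_product, Finset.mem_filter, Finset.mem_univ, true_and] at hp
    obtain ⟨⟨h1, h2⟩, h3, h4⟩ := hp
    have hI := isInterval_Icc (h1.trans h3)
    simp only [Finset.mem_filter, mem_intv]
    refine ⟨hI, ?_⟩
    obtain ⟨g1, g2⟩ := htop _ hI
    refine anti _ _ ?_ (g2 i (by simp [h1, h3]))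
    rw [Finset.mem_Icc] at g1
    rcases le_total (top (Finset.Icc a b)) i with h | h
    · exact convL _ _ _ h2 g1.1 h
    · exact convR _ _ _ h4 h g1.2
  · rintro ⟨a, b⟩ hp ⟨a', b'⟩ hp' h
    simp only [Finset.mem_product, Finset.mem_filter, Finset.mem_univ, true_and] at hp hp'
    have hab := hp.1.1.trans hp.2.1
    have hab' := hp'.1.1.trans hp'.2.1
    have h : Finset.Icc a b = Finset.Icc a' b' := h
    have k1 : a ∈ Finset.Icc a' b' := by rw [← h]; simp [hab]
    have k2 : b ∈ Finset.Icc a' b' := by rw [← h]; simp [hab]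
    have k3 : a' ∈ Finset.Icc a b := by rw [h]; simp [hab']
    have k4 : b' ∈ Finset.Icc a b := by rw [h]; simp [hab']
    rw [Finset.mem_Icc] at k1 k2 k3 k4
    rw [Prod.mk.injEq]
    exact ⟨le_antisymm k3.1 k1.1, le_antisymm k2.2 k4.2⟩
  · intro I hI
    simp only [Finset.mem_filter, mem_intv] at hI
    obtain ⟨hI, rfl⟩ := hI
    obtain ⟨g1, g2⟩ := htop _ hI
    refine ⟨(I.min' hI.1, I.max' hI.1), ?_, hI.eq_Icc.symm⟩
    simp only [Finset.mem_product, Finset.mem_filter, Finset.mem_univ, true_and]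
    exact ⟨⟨Finset.min'_le _ _ g1, g2 _ (Finset.min'_mem _ _)⟩,
      Finset.le_max' _ _ g1, g2 _ (Finset.max'_mem _ _)⟩

end Tree

/-! ### Geometry of the target tree -/

namespace Rectangulation

section Geometry

variable {n : ℕ} (R : Rectangulation n)

theorem eq_of_overlap {i j : Fin n} (h1 : R.xl i < R.xr j) (h2 : R.xl j < R.xr i)
    (h3 : R.yb i < R.yt j) (h4 : R.yb j < R.yt i) : i = j := by
  by_contra hne
  apply R.interiors_disjoint i j hne
  obtain ⟨x, hx1, hx2⟩ := exists_between
    (show max (R.xl i) (R.xl j) < min (R.xr i) (R.xr j) from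
      max_lt (lt_min (R.lt_x i) h1) (lt_min h2 (R.lt_x j)))
  obtain ⟨y, hy1, hy2⟩ := exists_between
    (show max (R.yb i) (R.yb j) < min (R.yt i) (R.yt j) from
      max_lt (lt_min (R.lt_y i) h3) (lt_min h4 (R.lt_y j)))
  rw [max_lt_iff] at hx1 hy1
  rw [lt_min_iff] at hx2 hy2
  exact ⟨(x, y), ⟨hx1.1, hx2.1, hy1.1, hy2.1⟩, hx1.2, hx2.2, hy1.2, hy2.2⟩

theorem near_right (f : Fin n → ℝ) (p : ℝ) (hp : p < 1) :
    ∃ x, p < x ∧ x ≤ 1 ∧ ∀ i, f i ≤ x → f i ≤ p := by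
  obtain ⟨m, hm, hmin⟩ := Finset.exists_min_image
    (insert 1 ((Finset.univ.image f).filter (fun z => p < z))) id ⟨1, by simp⟩
  have hpm : p < m := by
    rw [Finset.mem_insert, Finset.mem_filter] at hm
    rcases hm with rfl | hm
    · exact hp
    · exact hm.2
  have hm1 : m ≤ 1 := hmin 1 (by simp)
  refine ⟨(p + m) / 2, by linarith, by linarith, ?_⟩
  intro i hi
  by_contra hlt
  push Not at hlt
  have := hmin (f i) (by simp [hlt])
  simp only [id] at this
  linarith

theorem near_left (f : Fin n → ℝ) (p : ℝ) (hp : 0 < p) :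
    ∃ x, x < p ∧ 0 ≤ x ∧ ∀ i, x ≤ f i → p ≤ f i := by
  obtain ⟨x, h1, h2, h3⟩ := near_right (fun i => 1 - f i) (1 - p) (by linarith)
  refine ⟨1 - x, by linarith, by linarith, ?_⟩
  intro i hi
  have := h3 i (by linarith)
  linarith

theorem quadNW {px py : ℝ} (h1 : 0 < px) (h2 : px ≤ 1) (h3 : 0 ≤ py) (h4 : py < 1) :
    ∃ A, R.xl A < px ∧ px ≤ R.xr A ∧ R.yb A ≤ py ∧ py < R.yt A := by
  obtain ⟨x, hx1, hx2, hx3⟩ := near_left R.xr px h1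
  obtain ⟨y, hy1, hy2, hy3⟩ := near_right R.yb py h4
  obtain ⟨A, a1, a2, a3, a4⟩ := R.cover (x, y) hx2 (by simp; linarith) (by simp; linarith) hy2
  simp only at a1 a2 a3 a4
  exact ⟨A, by linarith, hx3 _ a2, hy3 _ a3, by linarith⟩

theorem quadSE {px py : ℝ} (h1 : 0 ≤ px) (h2 : px < 1) (h3 : 0 < py) (h4 : py ≤ 1) :
    ∃ A, R.xl A ≤ px ∧ px < R.xr A ∧ R.yb A < py ∧ py ≤ R.yt A := by
  obtain ⟨x, hx1, hx2, hx3⟩ := near_right R.xl px h2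
  obtain ⟨y, hy1, hy2, hy3⟩ := near_left R.yt py h3
  obtain ⟨A, a1, a2, a3, a4⟩ := R.cover (x, y) (by simp; linarith) hx2 hy2 (by simp; linarith)
  simp only at a1 a2 a3 a4
  exact ⟨A, hx3 _ a1, by linarith, by linarith, hy3 _ a4⟩

theorem quadNE {px py : ℝ} (h1 : 0 ≤ px) (h2 : px < 1) (h3 : 0 ≤ py) (h4 : py < 1) :
    ∃ A, R.xl A ≤ px ∧ px < R.xr A ∧ R.yb A ≤ py ∧ py < R.yt A := by
  obtain ⟨x, hx1, hx2, hx3⟩ := near_right R.xl px h2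
  obtain ⟨y, hy1, hy2, hy3⟩ := near_right R.yb py h4
  obtain ⟨A, a1, a2, a3, a4⟩ := R.cover (x, y) (by simp; linarith) hx2 (by simp; linarith) hy2
  simp only at a1 a2 a3 a4
  exact ⟨A, hx3 _ a1, by linarith, hy3 _ a3, by linarith⟩

theorem exists_parent (r : Fin n) (h : ¬ (R.xr r = 1 ∧ R.yt r = 1)) :
    ∃ q, R.TEdgeH r q ∨ R.TEdgeV r q := by
  have b1 := R.lt_x r
  have b2 := R.lt_y r
  have b3 := R.xl_nonneg r
  have b4 := R.yb_nonneg r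
  have b5 := R.xr_le_one r
  have b6 := R.yt_le_one r
  -- the north-west rectangle
  have hA : R.yt r < 1 → ∃ A, R.xl A < R.xr r ∧ R.xr r ≤ R.xr A ∧ R.yb A = R.yt r := by
    intro hy
    obtain ⟨A, a1, a2, a3, a4⟩ := R.quadNW (px := R.xr r) (py := R.yt r)
      (by linarith) b5 (by linarith) hy
    refine ⟨A, a1, a2, le_antisymm a3 ?_⟩
    by_contra hlt
    push Not at hlt
    have := R.eq_of_overlap (i := A) (j := r) a1 (by linarith) hlt (by linarith)
    subst this
    exact lt_irrefl _ a4
  have hC : R.xr r < 1 → ∃ C, R.yb C < R.yt r ∧ R.yt r ≤ R.yt C ∧ R.xl C = R.xr r := by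
    intro hx
    obtain ⟨A, a1, a2, a3, a4⟩ := R.quadSE (px := R.xr r) (py := R.yt r)
      (by linarith) hx (by linarith) b6
    refine ⟨A, a3, a4, le_antisymm a1 ?_⟩
    by_contra hlt
    push Not at hlt
    have := R.eq_of_overlap (i := A) (j := r) hlt (by linarith) a3 (by linarith)
    subst this
    exact lt_irrefl _ a2
  by_cases hx : R.xr r < 1
  · obtain ⟨C, c1, c2, c3⟩ := hC hx
    by_cases hc : R.yt C = R.yt r
    · exact ⟨C, Or.inl ⟨c3, hc⟩⟩
    have c2 : R.yt r < R.yt C := lt_of_le_of_ne c2 (Ne.symm hc)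
    by_cases hy : R.yt r < 1
    · obtain ⟨A, a1, a2, a3⟩ := hA hy
      by_cases ha : R.xr A = R.xr r
      · exact ⟨A, Or.inr ⟨ha, a3⟩⟩
      have a2 : R.xr r < R.xr A := lt_of_le_of_ne a2 (Ne.symm ha)
      have := R.lt_x C
      have := R.lt_y A
      have := R.eq_of_overlap (i := A) (j := C) (by linarith) (by linarith) (by linarith)
        (by linarith)
      subst this
      linarith
    · have := R.yt_le_one C
      exact absurd (by linarith) hy
  · have hx1 : R.xr r = 1 := by linarith
    have hy : R.yt r < 1 := lt_of_le_of_ne b6 (fun h' => h ⟨hx1, h'⟩)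
    obtain ⟨A, a1, a2, a3⟩ := hA hy
    exact ⟨A, Or.inr ⟨le_antisymm (by rw [hx1]; exact R.xr_le_one A) a2, a3⟩⟩

theorem pot_H {r q : Fin n} (h : R.TEdgeH r q) : R.xr r + R.yt r < R.xr q + R.yt q := by
  have := R.lt_x q
  obtain ⟨h1, h2⟩ := h
  linarith

theorem pot_V {r q : Fin n} (h : R.TEdgeV r q) : R.xr r + R.yt r < R.xr q + R.yt q := by
  have := R.lt_y q
  obtain ⟨h1, h2⟩ := h
  linarith

theorem eq_of_target {r s : Fin n} (h1 : R.xr r = R.xr s) (h2 : R.yt r = R.yt s) : r = s := by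
  have := R.lt_x r
  have := R.lt_y r
  have := R.lt_x s
  have := R.lt_y s
  exact R.eq_of_overlap (by linarith) (by linarith) (by linarith) (by linarith)

theorem exists_root : ∃ ρ, ∀ a, R.TReach a ρ := by
  obtain ⟨ρ, h1, h2, h3, h4⟩ := R.cover (1, 1) (by simp) (by simp) (by simp) (by simp)
  simp only at h1 h2 h3 h4
  have e1 := le_antisymm h2 (R.xr_le_one ρ)
  have e2 := le_antisymm h4 (R.yt_le_one ρ)
  refine ⟨ρ, ?_⟩
  intro a
  -- take a reachable node of maximal potential
  obtain ⟨c, hc, hmax⟩ := Finset.exists_max_image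
    (Finset.univ.filter (fun c => R.TReach a c)) (fun c => R.xr c + R.yt c)
    ⟨a, Finset.mem_filter.2 ⟨Finset.mem_univ _, Relation.ReflTransGen.refl⟩⟩
  simp only [Finset.mem_filter, Finset.mem_univ, true_and] at hc hmax
  by_cases h : R.xr c = 1 ∧ R.yt c = 1
  · have : c = ρ := R.eq_of_target (h.1.trans e1) (h.2.trans e2)
    rw [← this]; exact hc
  · obtain ⟨q, hq⟩ := R.exists_parent c h
    have h1 := hmax q (Relation.ReflTransGen.tail hc hq)
    rcases hq with hq | hq
    · have := R.pot_H hq; linarith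
    · have := R.pot_V hq; linarith

variable {R}

theorem InorderLabeled.lt_of_right (hR : R.InorderLabeled) {i j : Fin n}
    (h : R.DirRightOf j i) : i < j :=
  (hR i j).1 (Relation.TransGen.single (Or.inl (Relation.TransGen.single h)))

theorem InorderLabeled.lt_of_above (hR : R.InorderLabeled) {i j : Fin n}
    (h : R.DirAbove i j) : i < j :=
  (hR i j).1 (Relation.TransGen.single (Or.inr (Relation.TransGen.single h)))

theorem InorderLabeled.hsub_lt (hR : R.InorderLabeled) {a r q : Fin n} (h : R.TEdgeH r q)
    (ha : R.TReach a r) : a < q := by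
  have fin : ∀ a c : Fin n, R.xl c = R.xr a → R.yt a ≤ R.yt c →
      (∀ y, R.yb a ≤ y → y ≤ R.yt c → R.OnVertEdge (R.xl c, y)) → a < c := by
    intro a c h1 h2 h3
    apply hR.lt_of_right
    refine ⟨h1, ?_, ?_, ?_⟩
    · have := R.xl_nonneg a
      have := R.lt_x a
      linarith
    · have := R.xr_le_one c
      have := R.lt_x c
      linarith
    · intro y hy1 hy2
      rw [max_eq_left h2] at hy2
      rcases le_or_gt (R.yb a) y with h | h
      · exact h3 y h hy2
      · rcases min_le_iff.1 hy1 with h' | h'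
        · exact ⟨c, Or.inl rfl, h', hy2⟩
        · linarith
  suffices H : ∃ c, c ≤ q ∧ R.xl c = R.xr a ∧ R.yt a ≤ R.yt c ∧
      (∀ y, R.yb a ≤ y → y ≤ R.yt c → R.OnVertEdge (R.xl c, y)) by
    obtain ⟨c, h0, h1, h2, h3⟩ := H
    exact (fin a c h1 h2 h3).trans_le h0
  unfold TReach at ha
  induction ha using Relation.ReflTransGen.head_induction_on with
  | refl =>
    refine ⟨q, le_rfl, h.1, h.2.ge, ?_⟩
    intro y hy1 hy2
    exact ⟨r, Or.inr h.1, hy1, by rw [← h.2]; exact hy2⟩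
  | head hab hreach ih =>
    rename_i a b
    obtain ⟨c, h0, h1, h2, h3⟩ := ih
    rcases hab with hab | hab
    · refine ⟨b, (fin b c h1 h2 h3).le.trans h0, hab.1, hab.2.ge, ?_⟩
      intro y hy1 hy2
      exact ⟨a, Or.inr hab.1, hy1, by rw [← hab.2]; exact hy2⟩
    · obtain ⟨e1, e2⟩ := hab
      have := R.lt_y b
      refine ⟨c, h0, h1.trans e1, by linarith, ?_⟩
      intro y hy1 hy2
      rcases le_or_gt (R.yb b) y with g | g
      · exact h3 y g hy2
      · exact ⟨a, Or.inr (h1.trans e1), hy1, by linarith⟩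

theorem InorderLabeled.vsub_lt (hR : R.InorderLabeled) {a r q : Fin n} (h : R.TEdgeV r q)
    (ha : R.TReach a r) : q < a := by
  have fin : ∀ a c : Fin n, R.yb c = R.yt a → R.xr a ≤ R.xr c →
      (∀ x, R.xl a ≤ x → x ≤ R.xr c → R.OnHorizEdge (x, R.yb c)) → c < a := by
    intro a c h1 h2 h3
    apply hR.lt_of_above
    refine ⟨h1, ?_, ?_, ?_⟩
    · have := R.yb_nonneg a
      have := R.lt_y a
      linarith
    · have := R.yt_le_one c
      have := R.lt_y c
      linarith
    · intro y hy1 hy2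
      rw [max_eq_left h2] at hy2
      rcases le_or_gt (R.xl a) y with h | h
      · exact h3 y h hy2
      · rcases min_le_iff.1 hy1 with h' | h'
        · exact ⟨c, Or.inl rfl, h', hy2⟩
        · linarith
  suffices H : ∃ c, q ≤ c ∧ R.yb c = R.yt a ∧ R.xr a ≤ R.xr c ∧
      (∀ x, R.xl a ≤ x → x ≤ R.xr c → R.OnHorizEdge (x, R.yb c)) by
    obtain ⟨c, h0, h1, h2, h3⟩ := H
    exact h0.trans_lt (fin a c h1 h2 h3)
  unfold TReach at ha
  induction ha using Relation.ReflTransGen.head_induction_on with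
  | refl =>
    refine ⟨q, le_rfl, h.2, h.1.ge, ?_⟩
    intro y hy1 hy2
    exact ⟨r, Or.inr h.2, hy1, by rw [← h.1]; exact hy2⟩
  | head hab hreach ih =>
    rename_i a b
    obtain ⟨c, h0, h1, h2, h3⟩ := ih
    rcases hab with hab | hab
    · obtain ⟨e1, e2⟩ := hab
      have := R.lt_x b
      refine ⟨c, h0, h1.trans e2, by linarith, ?_⟩
      intro y hy1 hy2
      rcases le_or_gt (R.xl b) y with g | g
      · exact h3 y g hy2
      · exact ⟨a, Or.inr (h1.trans e2), hy1, by linarith⟩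
    · refine ⟨b, h0.trans (fin b c h1 h2 h3).le, hab.2, hab.1.ge, ?_⟩
      intro y hy1 hy2
      exact ⟨a, Or.inr hab.2, hy1, by rw [← hab.1]; exact hy2⟩

theorem InorderLabeled.top_T (hR : R.InorderLabeled) :
    ∃ top : Finset (Fin n) → Fin n,
      (∀ I, IsInterval I → top I ∈ I ∧ ∀ a ∈ I, R.TReach a (top I)) ∧
      ∀ i, R.hT i * R.vT i = ((intv n).filter (fun I => top I = i)).card :=
  tree_top R.TEdgeH R.TEdgeV (fun i => R.xr i + R.yt i) (fun _ _ => R.pot_H) (fun _ _ => R.pot_V)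
    (fun _ _ _ h h' => R.eq_of_target (h.1.symm.trans h'.1) (h.2.symm.trans h'.2))
    (fun _ _ _ h h' => R.eq_of_target (h.1.symm.trans h'.1) (h.2.symm.trans h'.2))
    R.exists_root (fun _ _ _ h h' => hR.hsub_lt h h') (fun _ _ _ h h' => hR.vsub_lt h h')

/-- Reflection across the anti-diagonal direction, exchanging source and target trees. -/
def flip (R : Rectangulation n) : Rectangulation n where
  xl i := 1 - R.yt i
  xr i := 1 - R.yb i
  yb i := 1 - R.xr i
  yt i := 1 - R.xl i
  lt_x i := by have := R.lt_y i; linarith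
  lt_y i := by have := R.lt_x i; linarith
  xl_nonneg i := by have := R.yt_le_one i; linarith
  xr_le_one i := by have := R.yb_nonneg i; linarith
  yb_nonneg i := by have := R.xr_le_one i; linarith
  yt_le_one i := by have := R.xl_nonneg i; linarith
  interiors_disjoint i j hij := by
    rintro ⟨p, ⟨h1, h2, h3, h4⟩, h5, h6, h7, h8⟩
    exact R.interiors_disjoint i j hij ⟨(1 - p.2, 1 - p.1),
      ⟨by simp only; linarith, by simp only; linarith, by simp only; linarith,
        by simp only; linarith⟩,
      by simp only; linarith, by simp only; linarith, by simp only; linarith,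
        by simp only; linarith⟩
  cover p h1 h2 h3 h4 := by
    obtain ⟨i, g1, g2, g3, g4⟩ := R.cover (1 - p.2, 1 - p.1) (by simp only; linarith)
      (by simp only; linarith) (by simp only; linarith) (by simp only; linarith)
    simp only at g1 g2 g3 g4
    exact ⟨i, by linarith, by linarith, by linarith, by linarith⟩

theorem flip_onHoriz (x y : ℝ) : R.flip.OnHorizEdge (x, y) ↔ R.OnVertEdge (1 - y, 1 - x) := by
  unfold OnHorizEdge OnVertEdge flip
  simp only
  apply exists_congr
  intro i
  constructor
  · rintro ⟨h | h, h1, h2⟩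
    · exact ⟨Or.inr (by linarith), by linarith, by linarith⟩
    · exact ⟨Or.inl (by linarith), by linarith, by linarith⟩
  · rintro ⟨h | h, h1, h2⟩
    · exact ⟨Or.inr (by linarith), by linarith, by linarith⟩
    · exact ⟨Or.inl (by linarith), by linarith, by linarith⟩

theorem flip_onVert (x y : ℝ) : R.flip.OnVertEdge (x, y) ↔ R.OnHorizEdge (1 - y, 1 - x) := by
  unfold OnHorizEdge OnVertEdge flip
  simp only
  apply exists_congr
  intro i
  constructor
  · rintro ⟨h | h, h1, h2⟩
    · exact ⟨Or.inr (by linarith), by linarith, by linarith⟩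
    · exact ⟨Or.inl (by linarith), by linarith, by linarith⟩
  · rintro ⟨h | h, h1, h2⟩
    · exact ⟨Or.inr (by linarith), by linarith, by linarith⟩
    · exact ⟨Or.inl (by linarith), by linarith, by linarith⟩

theorem flip_flip : R.flip.flip = R := by
  cases R
  simp [flip]

theorem flip_above {i j : Fin n} (h : R.DirRightOf j i) : R.flip.DirAbove i j := by
  obtain ⟨h1, h2, h3, h4⟩ := h
  refine ⟨by simp only [flip]; linarith, by simp only [flip]; linarith,
    by simp only [flip]; linarith, ?_⟩
  intro x hx1 hx2
  rw [flip_onHoriz]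
  simp only [flip] at hx1 hx2 ⊢
  have : (1 - (1 - R.xr i)) = R.xl j := by linarith
  rw [this]
  apply h4
  · rw [min_le_iff]
    rw [le_max_iff] at hx2
    rcases hx2 with h | h
    · right; linarith
    · left; linarith
  · rw [le_max_iff]
    rw [min_le_iff] at hx1
    rcases hx1 with h | h
    · right; linarith
    · left; linarith

theorem flip_right {i j : Fin n} (h : R.DirAbove i j) : R.flip.DirRightOf j i := by
  obtain ⟨h1, h2, h3, h4⟩ := h
  refine ⟨by simp only [flip]; linarith, by simp only [flip]; linarith,
    by simp only [flip]; linarith, ?_⟩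
  intro x hx1 hx2
  rw [flip_onVert]
  simp only [flip] at hx1 hx2 ⊢
  have : (1 - (1 - R.yt j)) = R.yb i := by linarith
  rw [this]
  apply h4
  · rw [min_le_iff]
    rw [le_max_iff] at hx2
    rcases hx2 with h | h
    · right; linarith
    · left; linarith
  · rw [le_max_iff]
    rw [min_le_iff] at hx1
    rcases hx1 with h | h
    · right; linarith
    · left; linarith

theorem flip_inorder {i j : Fin n} (h : R.InorderLT i j) : R.flip.InorderLT i j := by
  refine Relation.TransGen.mono ?_ _ _ h
  rintro a b (h | h)
  · right
    unfold Above
    rw [← Relation.transGen_swap]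
    exact Relation.TransGen.mono (fun _ _ h => flip_above h) _ _ h
  · left
    unfold RightOf
    rw [← Relation.transGen_swap]
    exact Relation.TransGen.mono (fun _ _ h => flip_right h) _ _ h

theorem InorderLabeled.flip (hR : R.InorderLabeled) : R.flip.InorderLabeled := by
  intro i j
  rw [← hR i j]
  refine ⟨fun h => ?_, flip_inorder⟩
  have := flip_inorder h
  rwa [flip_flip] at this

theorem flip_TEdgeH {r q : Fin n} : R.flip.TEdgeH r q ↔ R.SEdgeV q r := by
  simp only [TEdgeH, SEdgeV, Rectangulation.flip, sub_right_inj]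
  tauto

theorem flip_TEdgeV {r q : Fin n} : R.flip.TEdgeV r q ↔ R.SEdgeH q r := by
  simp only [TEdgeV, SEdgeH, Rectangulation.flip, sub_right_inj]
  tauto

theorem flip_TReach {a b : Fin n} : R.flip.TReach a b ↔ R.SReach b a := by
  unfold TReach SReach
  rw [← Relation.reflTransGen_swap]
  have : (Function.swap fun a b => R.flip.TEdgeH a b ∨ R.flip.TEdgeV a b) =
      (fun a b => R.SEdgeH a b ∨ R.SEdgeV a b) := by
    funext x y
    simp only [Function.swap, flip_TEdgeH, flip_TEdgeV, or_comm]
  rw [this]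

theorem InorderLabeled.top_S (hR : R.InorderLabeled) :
    ∃ top : Finset (Fin n) → Fin n,
      (∀ I, IsInterval I → top I ∈ I ∧ ∀ a ∈ I, R.SReach (top I) a) ∧
      ∀ i, R.hS i * R.vS i = ((intv n).filter (fun I => top I = i)).card := by
  obtain ⟨top, h1, h2⟩ := hR.flip.top_T
  refine ⟨top, fun I hI => ⟨(h1 I hI).1, fun a ha => flip_TReach.1 ((h1 I hI).2 a ha)⟩, ?_⟩
  intro i
  rw [← h2 i, mul_comm]
  congr 1
  · simp only [vS, hT, VSubS, HSubT, flip_TReach, flip_TEdgeH]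
  · simp only [hS, vT, HSubS, VSubT, flip_TReach, flip_TEdgeV]

end Geometry

end Rectangulation

/-! ### The diagonal rectangulation of a permutation -/

section Construction

/-- Lower end of the extent of `b`. -/
def lo (w : ℕ → ℤ) (b : ℕ) : ℕ :=
  Nat.find (p := fun i => ∀ k, i ≤ k → k < b → w b < w k) ⟨b, fun _ h h' => by omega⟩

/-- Upper end of the extent of `b`. -/
def hi (n : ℕ) (w : ℕ → ℤ) (b : ℕ) : ℕ :=
  Nat.find (p := fun i => ¬ (i < n ∧ ∀ k, b < k → k ≤ i → w k < w b)) ⟨n, fun h => by omega⟩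

theorem lo_le_iff {w : ℕ → ℤ} {b i : ℕ} :
    lo w b ≤ i ↔ ∀ k, i ≤ k → k < b → w b < w k := by
  unfold lo
  rw [Nat.find_le_iff]
  constructor
  · rintro ⟨m, hm, h⟩ k hk
    exact h k (hm.trans hk)
  · intro h
    exact ⟨i, le_rfl, h⟩

theorem lt_hi_iff {n : ℕ} {w : ℕ → ℤ} {b i : ℕ} :
    i < hi n w b ↔ i < n ∧ ∀ k, b < k → k ≤ i → w k < w b := by
  unfold hi
  rw [Nat.lt_find_iff]
  constructor
  · intro h
    exact not_not.1 (h i le_rfl)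
  · rintro ⟨h1, h2⟩ m hm h
    exact h ⟨by omega, fun k hk hk' => h2 k hk (by omega)⟩

theorem lo_le (w : ℕ → ℤ) (b : ℕ) : lo w b ≤ b := lo_le_iff.2 (fun k h h' => by omega)

theorem lt_hi {n : ℕ} (w : ℕ → ℤ) {b : ℕ} (hb : b < n) : b < hi n w b :=
  lt_hi_iff.2 ⟨hb, fun k h h' => by omega⟩

theorem hi_le (n : ℕ) (w : ℕ → ℤ) (b : ℕ) : hi n w b ≤ n := by
  by_contra h
  have := (lt_hi_iff.1 (not_le.1 h)).1
  omega

/-- The unit cell `(i, j)` belongs to the rectangle `b`. -/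
def Cell (n : ℕ) (w : ℕ → ℤ) (b i j : ℕ) : Prop :=
  (lo w b ≤ i ∧ i < hi n w b) ∧ lo (-w) b ≤ j ∧ j < hi n (-w) b

theorem Cell.neg {n : ℕ} {w : ℕ → ℤ} {b i j : ℕ} (h : Cell n w b i j) : Cell n (-w) b j i := by
  refine ⟨h.2, ?_⟩
  rw [neg_neg]
  exact h.1

theorem cell_neg {n : ℕ} {w : ℕ → ℤ} {b i j : ℕ} : Cell n (-w) b j i ↔ Cell n w b i j := by
  refine ⟨fun h => ?_, Cell.neg⟩
  have := h.neg
  rwa [neg_neg] at this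

theorem cell_iff_le {n : ℕ} {w : ℕ → ℤ} (hw : Function.Injective w) {b i j : ℕ}
    (hj : j < n) (hij : i ≤ j) :
    Cell n w b i j ↔ i ≤ b ∧ b ≤ j ∧ ∀ k, i ≤ k → k ≤ j → w b ≤ w k := by
  unfold Cell
  rw [lo_le_iff, lt_hi_iff, lo_le_iff, lt_hi_iff]
  simp only [Pi.neg_apply, neg_lt_neg_iff]
  constructor
  · rintro ⟨⟨h1, h2, h3⟩, h4, h5, h6⟩
    have a1 : i ≤ b := by
      by_contra h
      have e1 := h3 i (by omega) le_rfl
      have e2 := h6 i (by omega) hij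
      omega
    have a2 : b ≤ j := by
      by_contra h
      have e1 := h1 j hij (by omega)
      have e2 := h4 j le_rfl (by omega)
      omega
    refine ⟨a1, a2, ?_⟩
    intro k hk1 hk2
    rcases lt_trichotomy k b with h | h | h
    · exact (h1 k hk1 h).le
    · rw [h]
    · exact (h6 k h hk2).le
  · rintro ⟨h1, h2, h3⟩
    have h4 : ∀ k, i ≤ k → k ≤ j → k ≠ b → w b < w k := fun k a1 a2 a3 =>
      lt_of_le_of_ne (h3 k a1 a2) (fun e => a3 (hw e).symm)
    exact ⟨⟨fun k a1 a2 => h4 k a1 (by omega) (by omega), by omega, fun k a1 a2 => by omega⟩,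
      fun k a1 a2 => by omega, hj, fun k a1 a2 => h4 k (by omega) a2 (by omega)⟩

theorem neg_inj_fun {w : ℕ → ℤ} (hw : Function.Injective w) : Function.Injective (-w) := by
  intro a b h
  exact hw (neg_injective h)

theorem cell_iff_ge {n : ℕ} {w : ℕ → ℤ} (hw : Function.Injective w) {b i j : ℕ}
    (hi : i < n) (hij : j ≤ i) :
    Cell n w b i j ↔ j ≤ b ∧ b ≤ i ∧ ∀ k, j ≤ k → k ≤ i → w k ≤ w b := by
  rw [← cell_neg, cell_iff_le (neg_inj_fun hw) hi hij]
  simp only [Pi.neg_apply, neg_le_neg_iff]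

theorem cell_lt {n : ℕ} {w : ℕ → ℤ} {b i j : ℕ} (h : Cell n w b i j) : i < n ∧ j < n :=
  ⟨h.1.2.trans_le (hi_le _ _ _), h.2.2.trans_le (hi_le _ _ _)⟩

theorem cell_unique {n : ℕ} {w : ℕ → ℤ} (hw : Function.Injective w) {a b i j : ℕ}
    (ha : Cell n w a i j) (hb : Cell n w b i j) : a = b := by
  obtain ⟨hi, hj⟩ := cell_lt ha
  rcases le_total i j with h | h
  · rw [cell_iff_le hw hj h] at ha hb
    exact hw (le_antisymm (ha.2.2 b hb.1 hb.2.1) (hb.2.2 a ha.1 ha.2.1))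
  · rw [cell_iff_ge hw hi h] at ha hb
    exact hw (le_antisymm (hb.2.2 a ha.1 ha.2.1) (ha.2.2 b hb.1 hb.2.1))

theorem cell_exists {n : ℕ} {w : ℕ → ℤ} (hw : Function.Injective w) {i j : ℕ}
    (hi : i < n) (hj : j < n) : ∃ b, b < n ∧ Cell n w b i j := by
  rcases le_total i j with h | h
  · obtain ⟨b, hb, hmin⟩ := Finset.exists_min_image (Finset.Icc i j) w ⟨i, by simp [h]⟩
    simp only [Finset.mem_Icc, and_imp] at hb hmin
    exact ⟨b, by omega, (cell_iff_le hw hj h).2 ⟨hb.1, hb.2, hmin⟩⟩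
  · obtain ⟨b, hb, hmax⟩ := Finset.exists_max_image (Finset.Icc j i) w ⟨j, by simp [h]⟩
    simp only [Finset.mem_Icc, and_imp] at hb hmax
    exact ⟨b, by omega, (cell_iff_ge hw hi h).2 ⟨hb.1, hb.2, hmax⟩⟩

theorem cell_adj {n : ℕ} {w : ℕ → ℤ} (hw : Function.Injective w) {a b i j : ℕ}
    (ha : Cell n w a i j) (hb : Cell n w b (i + 1) j) : w a ≤ w b := by
  obtain ⟨h1, h2⟩ := cell_lt hb
  rcases lt_or_ge i j with h | h
  · rw [cell_iff_le hw h2 h.le] at ha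
    rw [cell_iff_le hw h2 h] at hb
    exact ha.2.2 b (by omega) hb.2.1
  · rw [cell_iff_ge hw (by omega) h] at ha
    rw [cell_iff_ge hw h1 (by omega)] at hb
    exact hb.2.2 a ha.1 (by omega)

theorem edge_le {n : ℕ} {w : ℕ → ℤ} (hw : Function.Injective w) {a b j : ℕ} (ha : a < n)
    (h : hi n w a = lo w b) (hb : b < n)
    (h1 : lo (-w) a ≤ j) (h2 : j < hi n (-w) a) (h3 : lo (-w) b ≤ j) (h4 : j < hi n (-w) b) :
    w a ≤ w b := by
  have e1 := lt_hi w ha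
  have e2 := lo_le w a
  have e3 := lt_hi w hb
  have e4 := lo_le w b
  refine cell_adj hw (i := hi n w a - 1) (j := j) ⟨⟨by omega, by omega⟩, h1, h2⟩
    ⟨⟨by omega, by omega⟩, h3, h4⟩

theorem no_cross {n : ℕ} {w : ℕ → ℤ} (hw : Function.Injective w) {X U : ℕ} {a b c d : ℕ}
    (h00 : Cell n w a (X + 1) (U + 1)) (h11 : Cell n w b X U) (h10 : Cell n w c X (U + 1))
    (h01 : Cell n w d (X + 1) U) : c = a ∨ c = b ∨ d = a ∨ d = b := by
  obtain ⟨hX, hU⟩ := cell_lt h00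
  rcases le_total X U with h | h
  · have h10' := h10
    rw [cell_iff_le hw hU (by omega)] at h10
    obtain ⟨g1, g2, g3⟩ := h10
    by_cases hc : c ≤ U
    · right; left
      refine cell_unique hw ((cell_iff_le hw (by omega) h).2 ⟨g1, hc, ?_⟩) h11
      exact fun k a1 a2 => g3 k a1 (by omega)
    · left
      refine cell_unique hw ((cell_iff_le hw (by omega) (by omega)).2 ⟨by omega, g2, ?_⟩) h00
      exact fun k a1 a2 => g3 k (by omega) a2
  · rw [cell_iff_ge hw hX (by omega)] at h01
    obtain ⟨g1, g2, g3⟩ := h01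
    by_cases hc : d ≤ X
    · right; right; right
      refine cell_unique hw ((cell_iff_ge hw (by omega) h).2 ⟨g1, hc, ?_⟩) h11
      exact fun k a1 a2 => g3 k a1 (by omega)
    · right; right; left
      refine cell_unique hw ((cell_iff_ge hw (by omega) (by omega)).2 ⟨by omega, g2, ?_⟩) h00
      exact fun k a1 a2 => g3 k (by omega) a2

/-- Locating a point of `[0,1]` in a cell. -/
theorem exists_cell_idx {n : ℕ} (hn : 0 < n) {x : ℝ} (h0 : 0 ≤ x) (h1 : x ≤ 1) :
    ∃ i : ℕ, i < n ∧ (i : ℝ) ≤ x * n ∧ x * n ≤ i + 1 := by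
  have hn' : (0 : ℝ) < n := by exact_mod_cast hn
  have hx : 0 ≤ x * n := by positivity
  have hxn : x * n ≤ n := by nlinarith
  by_cases h : ⌊x * n⌋₊ < n
  · exact ⟨_, h, Nat.floor_le hx, (Nat.lt_floor_add_one _).le⟩
  · push Not at h
    have h2 := (Nat.cast_le (α := ℝ)).2 h
    have h3 := Nat.floor_le hx
    have e : ((n - 1 : ℕ) : ℝ) = n - 1 := by push_cast [Nat.cast_sub hn]; ring
    exact ⟨n - 1, by omega, by rw [e]; linarith, by rw [e]; linarith⟩

/-- The diagonal rectangulation associated with the linear order `w`. -/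
def diagRect (n : ℕ) (hn : 0 < n) (w : ℕ → ℤ) (hw : Function.Injective w) :
    Rectangulation n where
  xl b := (lo w b : ℝ) / n
  xr b := (hi n w b : ℝ) / n
  yb b := 1 - (hi n (-w) b : ℝ) / n
  yt b := 1 - (lo (-w) b : ℝ) / n
  lt_x b := by
    have hn' : (0 : ℝ) < n := by exact_mod_cast hn
    have : lo w b < hi n w b := (lo_le w b).trans_lt (lt_hi w b.2)
    have : (lo w b : ℝ) < hi n w b := by exact_mod_cast this
    gcongr
  lt_y b := by
    have hn' : (0 : ℝ) < n := by exact_mod_cast hn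
    have : lo (-w) b < hi n (-w) b := (lo_le (-w) b).trans_lt (lt_hi (-w) b.2)
    have : (lo (-w) b : ℝ) < hi n (-w) b := by exact_mod_cast this
    gcongr
  xl_nonneg b := by positivity
  xr_le_one b := by
    have hn' : (0 : ℝ) < n := by exact_mod_cast hn
    rw [div_le_one hn']
    exact_mod_cast hi_le n w b
  yb_nonneg b := by
    have hn' : (0 : ℝ) < n := by exact_mod_cast hn
    rw [sub_nonneg, div_le_one hn']
    exact_mod_cast hi_le n (-w) b
  yt_le_one b := by
    have : (0 : ℝ) ≤ (lo (-w) b : ℝ) / n := by positivity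
    linarith
  interiors_disjoint a b hab := by
    rintro ⟨⟨x, y⟩, ⟨h1, h2, h3, h4⟩, h5, h6, h7, h8⟩
    have hn' : (0 : ℝ) < n := by exact_mod_cast hn
    simp only at h1 h2 h3 h4 h5 h6 h7 h8
    have key : ∀ c : Fin n, (lo w c : ℝ) / n < x → x < (hi n w c : ℝ) / n →
        1 - (hi n (-w) c : ℝ) / n < y → y < 1 - (lo (-w) c : ℝ) / n →
        Cell n w c ⌊x * n⌋₊ ⌊(1 - y) * n⌋₊ := by
      intro c g1 g2 g3 g4
      have g3' : 1 - y < (hi n (-w) c : ℝ) / n := by linarith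
      have g4' : (lo (-w) c : ℝ) / n < 1 - y := by linarith
      rw [div_lt_iff₀ hn'] at g1 g4'
      rw [lt_div_iff₀ hn'] at g2 g3'
      have p1 : 0 ≤ x * n := le_trans (Nat.cast_nonneg _) g1.le
      have p2 : 0 ≤ (1 - y) * n := le_trans (Nat.cast_nonneg _) g4'.le
      exact ⟨⟨Nat.le_floor g1.le, (Nat.floor_lt p1).2 g2⟩,
        Nat.le_floor g4'.le, (Nat.floor_lt p2).2 g3'⟩
    exact hab (Fin.ext (cell_unique hw (key a h1 h2 h3 h4) (key b h5 h6 h7 h8)))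
  cover p h1 h2 h3 h4 := by
    have hn' : (0 : ℝ) < n := by exact_mod_cast hn
    obtain ⟨i, i1, i2, i3⟩ := exists_cell_idx hn h1 h2
    obtain ⟨j, j1, j2, j3⟩ := exists_cell_idx hn (x := 1 - p.2) (by linarith) (by linarith)
    obtain ⟨b, hb, ⟨c1, c2⟩, c3, c4⟩ := cell_exists hw i1 j1
    have d1 : (lo w b : ℝ) ≤ i := by exact_mod_cast c1
    have d2 : (i : ℝ) + 1 ≤ hi n w b := by exact_mod_cast c2
    have d3 : (lo (-w) b : ℝ) ≤ j := by exact_mod_cast c3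
    have d4 : (j : ℝ) + 1 ≤ hi n (-w) b := by exact_mod_cast c4
    refine ⟨⟨b, hb⟩, ?_, ?_, ?_, ?_⟩
    · simp only; rw [div_le_iff₀ hn']; linarith
    · simp only; rw [le_div_iff₀ hn']; linarith
    · have : 1 - p.2 ≤ (hi n (-w) b : ℝ) / n := by rw [le_div_iff₀ hn']; linarith
      simp only; linarith
    · have : (lo (-w) b : ℝ) / n ≤ 1 - p.2 := by rw [div_le_iff₀ hn']; linarith
      simp only; linarith

variable {n : ℕ} {hn : 0 < n} {w : ℕ → ℤ} {hw : Function.Injective w}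

theorem cast_div_inj (hn : 0 < n) {a b : ℕ} (h : (a : ℝ) / n = (b : ℝ) / n) : a = b := by
  have hn' : (n : ℝ) ≠ 0 := by exact_mod_cast hn.ne'
  rw [div_left_inj' hn'] at h
  exact_mod_cast h

theorem one_sub_inj (hn : 0 < n) {a b : ℕ} (h : 1 - (a : ℝ) / n = 1 - (b : ℝ) / n) : a = b :=
  cast_div_inj hn (by linarith)

theorem diagRect_generic : (diagRect n hn w hw).Generic := by
  rintro ⟨p, i, j, k, l, h1, h2, h3, h4, h5, h6, ci, cj, ck, cl⟩
  obtain ⟨X, U, hX, hU⟩ : ∃ X U : ℕ, p.1 = (X : ℝ) / n ∧ p.2 = 1 - (U : ℝ) / n := by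
    obtain ⟨a | a, b | b⟩ := ci
    all_goals exact ⟨_, _, a, b⟩
  have key : ∀ r : Fin n, (diagRect n hn w hw).IsCorner r p →
      ∃ s t : Fin 2, ∃ x u : ℕ, x + s = X ∧ u + t = U ∧ Cell n w r x u := by
    intro r hr
    have e1 := lt_hi w r.2
    have e2 := lo_le w r
    have e3 := lt_hi (-w) r.2
    have e4 := lo_le (-w) r
    obtain ⟨a, b⟩ := hr
    rw [hX] at a
    rw [hU] at b
    obtain ⟨s, x, hs, hx⟩ : ∃ s : Fin 2, ∃ x : ℕ, x + s = X ∧ lo w r ≤ x ∧ x < hi n w r := by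
      rcases a with a | a
      · have := cast_div_inj hn a
        exact ⟨0, X, by simp, by omega, by omega⟩
      · have := cast_div_inj hn a
        exact ⟨1, X - 1, by simp; omega, by omega, by omega⟩
    obtain ⟨t, u, ht, hu⟩ : ∃ t : Fin 2, ∃ u : ℕ, u + t = U ∧ lo (-w) r ≤ u ∧
        u < hi n (-w) r := by
      rcases b with b | b
      · have := one_sub_inj hn b
        exact ⟨1, U - 1, by simp; omega, by omega, by omega⟩
      · have := one_sub_inj hn b
        exact ⟨0, U, by simp, by omega, by omega⟩
    exact ⟨s, t, x, u, hs, ht, hx, hu⟩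
  let f : Fin 4 → Fin n := ![i, j, k, l]
  have hf : Function.Injective f := by
    intro a b hab
    fin_cases a <;> fin_cases b <;> simp_all [f]
  have hc : ∀ a, (diagRect n hn w hw).IsCorner (f a) p := by
    intro a
    fin_cases a
    · exact ci
    · exact cj
    · exact ck
    · exact cl
  choose s t x u hs ht hcell using fun a => key (f a) (hc a)
  let g : Fin 4 → Fin 2 × Fin 2 := fun a => (s a, t a)
  have hg : Function.Injective g := by
    intro a b hab
    simp only [g, Prod.mk.injEq] at hab
    have q1 := hs a
    have q2 := hs b
    have q3 := ht a
    have q4 := ht b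
    rw [hab.1] at q1
    rw [hab.2] at q3
    have r1 : x a = x b := by omega
    have r2 : u a = u b := by omega
    have c1 := hcell a
    rw [r1, r2] at c1
    exact hf (Fin.ext (cell_unique hw c1 (hcell b)))
  have hsurj : Function.Surjective g :=
    (hg.bijective_of_nat_card_le (by simp)).2
  obtain ⟨a, ha⟩ := hsurj (0, 0)
  obtain ⟨b, hb⟩ := hsurj (1, 1)
  obtain ⟨c, hc'⟩ := hsurj (1, 0)
  obtain ⟨d, hd⟩ := hsurj (0, 1)
  have h00 := hcell a
  have h11 := hcell b
  have h10 := hcell c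
  have h01 := hcell d
  simp only [g, Prod.mk.injEq] at ha hb hc' hd
  have a1 := hs a
  have a2 := ht a
  have b1 := hs b
  have b2 := ht b
  have c1 := hs c
  have c2 := ht c
  have d1 := hs d
  have d2 := ht d
  simp only [ha.1, ha.2, hb.1, hb.2, hc'.1, hc'.2, hd.1, hd.2, Fin.val_zero, Fin.val_one]
    at a1 a2 b1 b2 c1 c2 d1 d2
  have k1 : x a = x b + 1 := by omega
  have k2 : u a = u b + 1 := by omega
  have k3 : x c = x b := by omega
  have k4 : u c = u b + 1 := by omega
  have k5 : x d = x b + 1 := by omega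
  have k6 : u d = u b := by omega
  rw [k1, k2] at h00
  rw [k3, k4] at h10
  rw [k5, k6] at h01
  have fin : ∀ y z : Fin 4, ((f y : Fin n) : ℕ) = f z → s y = s z ∧ t y = t z := by
    intro y z h
    have := hf (Fin.ext h)
    rw [this]; exact ⟨rfl, rfl⟩
  rcases no_cross hw h00 h11 h10 h01 with h | h | h | h
  · have := (fin _ _ h).1
    rw [hc'.1, ha.1] at this
    exact absurd this (by decide)
  · have := (fin _ _ h).2
    rw [hc'.2, hb.2] at this
    exact absurd this (by decide)
  · have := (fin _ _ h).2
    rw [hd.2, ha.2] at this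
    exact absurd this (by decide)
  · have := (fin _ _ h).1
    rw [hd.1, hb.1] at this
    exact absurd this (by decide)

theorem hi_eq_succ {b : ℕ} (hb : b + 1 < n) (h : w b < w (b + 1)) : hi n w b = b + 1 := by
  apply le_antisymm
  · by_contra hlt
    have := (lt_hi_iff.1 (not_le.1 hlt)).2 (b + 1) (by omega) le_rfl
    omega
  · exact lt_hi w (by omega)

theorem lo_eq_self {b : ℕ} (h : w b < w (b + 1)) : lo w (b + 1) = b + 1 := by
  apply le_antisymm (lo_le _ _)
  by_contra hlt
  have := lo_le_iff.1 (show lo w (b + 1) ≤ b by omega) b le_rfl (by omega)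
  omega

theorem between_union {a b c d m y : ℝ} (h1 : a ≤ m) (h2 : m ≤ b) (h3 : c ≤ m) (h4 : m ≤ d)
    (hy1 : min a c ≤ y) (hy2 : y ≤ max b d) : (a ≤ y ∧ y ≤ b) ∨ (c ≤ y ∧ y ≤ d) := by
  rcases le_total y m with h | h
  · rcases min_le_iff.1 hy1 with g | g
    · exact Or.inl ⟨g, h.trans h2⟩
    · exact Or.inr ⟨g, h.trans h4⟩
  · rcases le_max_iff.1 hy2 with g | g
    · exact Or.inl ⟨h1.trans h, g⟩
    · exact Or.inr ⟨h3.trans h, g⟩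

theorem diagRect_step {b : ℕ} (hb : b + 1 < n) :
    (diagRect n hn w hw).InorderLT ⟨b, by omega⟩ ⟨b + 1, hb⟩ := by
  apply Relation.TransGen.single
  have hn' : (0 : ℝ) < n := by exact_mod_cast hn
  have f1 : ∀ v : ℕ → ℤ, (lo v b : ℝ) / n ≤ ((b + 1 : ℕ) : ℝ) / n := by
    intro v
    have : lo v b ≤ b + 1 := (lo_le v b).trans (by omega)
    have : (lo v b : ℝ) ≤ ((b + 1 : ℕ) : ℝ) := by exact_mod_cast this
    gcongr
  have f2 : ∀ v : ℕ → ℤ, (lo v (b + 1) : ℝ) / n ≤ ((b + 1 : ℕ) : ℝ) / n := by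
    intro v
    have : lo v (b + 1) ≤ b + 1 := lo_le v _
    have : (lo v (b + 1) : ℝ) ≤ ((b + 1 : ℕ) : ℝ) := by exact_mod_cast this
    gcongr
  have f3 : ∀ v : ℕ → ℤ, ((b + 1 : ℕ) : ℝ) / n ≤ (hi n v b : ℝ) / n := by
    intro v
    have : b + 1 ≤ hi n v b := lt_hi v (by omega)
    have : ((b + 1 : ℕ) : ℝ) ≤ (hi n v b : ℝ) := by exact_mod_cast this
    gcongr
  have f4 : ∀ v : ℕ → ℤ, ((b + 1 : ℕ) : ℝ) / n ≤ (hi n v (b + 1) : ℝ) / n := by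
    intro v
    have : b + 1 ≤ hi n v (b + 1) := (lt_hi v hb).le
    have : ((b + 1 : ℕ) : ℝ) ≤ (hi n v (b + 1) : ℝ) := by exact_mod_cast this
    gcongr
  have pos : 0 < ((b + 1 : ℕ) : ℝ) / n := by positivity
  have lt1 : ((b + 1 : ℕ) : ℝ) / n < 1 := by
    rw [div_lt_one hn']; exact_mod_cast hb
  rcases lt_or_gt_of_ne (fun h => absurd (hw h) (by omega) : w b ≠ w (b + 1)) with h | h
  · left
    apply Relation.TransGen.single
    have e1 := hi_eq_succ hb h
    have e2 := lo_eq_self h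
    refine ⟨?_, ?_, ?_, ?_⟩
    · simp only [diagRect]; rw [e1, e2]
    · simp only [diagRect]; rw [e2]; exact pos
    · simp only [diagRect]; rw [e2]; exact lt1
    · intro y hy1 hy2
      simp only [diagRect] at hy1 hy2
      have a1 := f1 (-w)
      have a2 := f2 (-w)
      have a3 := f3 (-w)
      have a4 := f4 (-w)
      rcases between_union (m := 1 - ((b + 1 : ℕ) : ℝ) / n) (by linarith) (by linarith)
        (by linarith) (by linarith) hy1 hy2 with g | g
      · exact ⟨⟨b + 1, hb⟩, Or.inl rfl, g.1, g.2⟩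
      · refine ⟨⟨b, by omega⟩, Or.inr ?_, g.1, g.2⟩
        simp only [diagRect]; rw [e1, e2]
  · right
    apply Relation.TransGen.single
    have h' : (-w) b < (-w) (b + 1) := by simpa using h
    have e1 := hi_eq_succ hb h'
    have e2 := lo_eq_self h'
    refine ⟨?_, ?_, ?_, ?_⟩
    · simp only [diagRect]; rw [e1, e2]
    · simp only [diagRect]; rw [e1]; linarith
    · simp only [diagRect]; rw [e1]; linarith
    · intro y hy1 hy2
      simp only [diagRect] at hy1 hy2
      rcases between_union (f1 w) (f3 w) (f2 w) (f4 w) hy1 hy2 with g | g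
      · exact ⟨⟨b, by omega⟩, Or.inl rfl, g.1, g.2⟩
      · refine ⟨⟨b + 1, hb⟩, Or.inr ?_, g.1, g.2⟩
        simp only [diagRect]; rw [e1, e2]

theorem diagRect_inorder : (diagRect n hn w hw).InorderLabeled := by
  intro i j
  constructor
  · have right : ∀ i j, (diagRect n hn w hw).DirRightOf j i → i < j := by
      intro i j h
      have := cast_div_inj hn h.1
      have := lt_hi w i.2
      have := lo_le w j
      exact Fin.lt_def.2 (by omega)
    have above : ∀ i j, (diagRect n hn w hw).DirAbove i j → i < j := by
      intro i j h
      have := one_sub_inj hn h.1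
      have := lt_hi (-w) i.2
      have := lo_le (-w) j
      exact Fin.lt_def.2 (by omega)
    intro h
    have step : ∀ a b, ((diagRect n hn w hw).RightOf b a ∨ (diagRect n hn w hw).Above a b) →
        a < b := by
      rintro a b (h | h)
      · unfold Rectangulation.RightOf at h
        induction h with
        | single h => exact right _ _ h
        | tail _ h ih => exact (right _ _ h).trans ih
      · unfold Rectangulation.Above at h
        induction h with
        | single h => exact above _ _ h
        | tail _ h ih => exact ih.trans (above _ _ h)
    unfold Rectangulation.InorderLT at h
    induction h with
    | single h => exact step _ _ h
    | tail _ h ih => exact ih.trans (step _ _ h)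
  · intro h
    have H : ∀ m : ℕ, ∀ b : ℕ, ∀ hb : b + 1 + m < n,
        (diagRect n hn w hw).InorderLT ⟨b, by omega⟩ ⟨b + 1 + m, hb⟩ := by
      intro m
      induction m with
      | zero => intro b hb; exact diagRect_step hb
      | succ m ih =>
        intro b hb
        exact Relation.TransGen.trans (ih b (by omega)) (diagRect_step hb)
    obtain ⟨i, hi⟩ := i
    obtain ⟨j, hj⟩ := j
    have h : i < j := h
    obtain ⟨m, rfl⟩ := Nat.exists_eq_add_of_le (show i + 1 ≤ j from h)
    exact H m i hj

theorem diagRect_T {a b : Fin n} (h : (diagRect n hn w hw).TReach a b) : w a ≤ w b := by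
  unfold Rectangulation.TReach at h
  induction h with
  | refl => exact le_rfl
  | tail _ h ih =>
    refine ih.trans ?_
    rename_i b c _
    rcases h with ⟨h1, h2⟩ | ⟨h1, h2⟩
    · have h1 := cast_div_inj hn h1
      have h2 := one_sub_inj hn h2
      have e1 := lo_le (-w) b
      have e2 := lt_hi (-w) b.2
      have e3 := lo_le (-w) c
      have e4 := lt_hi (-w) c.2
      exact edge_le hw b.2 h1.symm c.2 (j := lo (-w) b) (by omega) (by omega) (by omega) (by omega)
    · have h1 := cast_div_inj hn h1
      have h2 := one_sub_inj hn h2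
      have e1 := lo_le w b
      have e2 := lt_hi w b.2
      have e3 := lo_le w c
      have e4 := lt_hi w c.2
      have := edge_le (neg_inj_fun hw) c.2 h2 b.2 (j := hi n w b - 1)
        (by rw [neg_neg] <;> omega) (by rw [neg_neg] <;> omega) (by rw [neg_neg] <;> omega)
        (by rw [neg_neg] <;> omega)
      simpa using this

theorem diagRect_S {a b : Fin n} (h : (diagRect n hn w hw).SReach a b) : w a ≤ w b := by
  unfold Rectangulation.SReach at h
  induction h with
  | refl => exact le_rfl
  | tail _ h ih =>
    refine ih.trans ?_
    rename_i b c _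
    rcases h with ⟨h1, h2⟩ | ⟨h1, h2⟩
    · have h1 := cast_div_inj hn h1
      have h2 := one_sub_inj hn h2
      have e1 := lo_le (-w) b
      have e2 := lt_hi (-w) b.2
      have e3 := lo_le (-w) c
      have e4 := lt_hi (-w) c.2
      exact edge_le hw b.2 h1 c.2 (j := hi n (-w) b - 1) (by omega) (by omega) (by omega)
        (by omega)
    · have h1 := cast_div_inj hn h1
      have h2 := one_sub_inj hn h2
      have e1 := lo_le w b
      have e2 := lt_hi w b.2
      have e3 := lo_le w c
      have e4 := lt_hi w c.2
      have := edge_le (neg_inj_fun hw) c.2 h2.symm b.2 (j := lo w b)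
        (by rw [neg_neg] <;> omega) (by rw [neg_neg] <;> omega) (by rw [neg_neg] <;> omega)
        (by rw [neg_neg] <;> omega)
      simpa using this

theorem exists_rect_of_perm (n : ℕ) (hn : 0 < n) (σ : Equiv.Perm (Fin n)) :
    ∃ R : Rectangulation n, R.Generic ∧ R.InorderLabeled ∧
      (∀ a b, R.TReach a b → σ a ≤ σ b) ∧ (∀ a b, R.SReach a b → σ a ≤ σ b) := by
  let w : ℕ → ℤ := fun k => if h : k < n then ((σ ⟨k, h⟩ : ℕ) : ℤ) else k
  have hwv : ∀ a : Fin n, w a = ((σ a : ℕ) : ℤ) := by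
    intro a
    simp [w]
  have hw : Function.Injective w := by
    intro a b h
    by_cases ha : a < n <;> by_cases hb : b < n
    · simp only [w, ha, hb, dif_pos, Nat.cast_inj] at h
      have := σ.injective (Fin.ext h)
      simpa using this
    · simp only [w, ha, hb, dif_pos, dif_neg, not_false_eq_true, Nat.cast_inj] at h
      have := (σ ⟨a, ha⟩).2
      omega
    · simp only [w, ha, hb, dif_pos, dif_neg, not_false_eq_true, Nat.cast_inj] at h
      have := (σ ⟨b, hb⟩).2
      omega
    · simp only [w, ha, hb, dif_neg, not_false_eq_true, Nat.cast_inj] at h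
      exact h
  refine ⟨diagRect n hn w hw, diagRect_generic, diagRect_inorder, ?_, ?_⟩
  · intro a b h
    have := diagRect_T h
    rw [hwv, hwv] at this
    exact Fin.le_def.2 (by exact_mod_cast this)
  · intro a b h
    have := diagRect_S h
    rw [hwv, hwv] at this
    exact Fin.le_def.2 (by exact_mod_cast this)

end Construction

/-! ### Assembling the proof -/

section Final

variable {n : ℕ}

theorem sum_fiber (top : Finset (Fin n) → Fin n) (X : Finset (Fin n)) :
    ∑ i ∈ X, ((intv n).filter (fun I => top I = i)).card =
      ((intv n).filter (fun I => top I ∈ X)).card := by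
  rw [Finset.card_eq_sum_card_fiberwise (f := top) (t := X)]
  · refine Finset.sum_congr rfl (fun i hi => ?_)
    congr 1
    ext I
    simp only [Finset.mem_filter]
    constructor
    · rintro ⟨h1, h2⟩
      exact ⟨⟨h1, h2 ▸ hi⟩, h2⟩
    · rintro ⟨⟨h1, _⟩, h2⟩
      exact ⟨h1, h2⟩
  · intro I hI
    exact (Finset.mem_filter.1 hI).2

theorem fWeak_add (X : Finset (Fin n)) :
    ((intv n).filter (fun I => ¬ I ⊆ Xᶜ)).card =
      fWeak n X + ((intv n).filter (fun I => I ⊆ X)).card := by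
  have h1 : fWeak n X = ((intv n).filter (fun I => ¬ I ⊆ X ∧ ¬ I ⊆ Xᶜ)).card := by
    unfold fWeak
    rw [← Set.ncard_coe_finset]
    congr 1
    ext I
    simp [mem_intv]
  rw [h1, ← Finset.card_union_of_disjoint]
  · congr 1
    ext I
    simp only [Finset.mem_union, Finset.mem_filter, mem_intv]
    constructor
    · rintro ⟨a, b⟩
      by_cases h : I ⊆ X
      · exact Or.inr ⟨a, h⟩
      · exact Or.inl ⟨a, h, b⟩
    · rintro (⟨a, _, b⟩ | ⟨a, b⟩)
      · exact ⟨a, b⟩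
      · refine ⟨a, fun h => ?_⟩
        obtain ⟨x, hx⟩ := a.1
        exact (Finset.mem_compl.1 (h hx)) (b hx)
  · rw [Finset.disjoint_left]
    intro I h h'
    exact (Finset.mem_filter.1 h).2.1 (Finset.mem_filter.1 h').2

/-- The point associated with a rectangulation. -/
def ptR (R : Rectangulation n) : Fin n → ℝ :=
  fun i => ((R.hT i * R.vT i : ℕ) : ℝ) - ((R.hS i * R.vS i : ℕ) : ℝ)

theorem ptR_data {R : Rectangulation n} (hR : R.InorderLabeled) :
    ∃ tT tS : Finset (Fin n) → Fin n,
      (∀ I, IsInterval I → tT I ∈ I ∧ ∀ a ∈ I, R.TReach a (tT I)) ∧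
      (∀ I, IsInterval I → tS I ∈ I ∧ ∀ a ∈ I, R.SReach (tS I) a) ∧
      ∀ X : Finset (Fin n), ∑ i ∈ X, ptR R i =
        (((intv n).filter (fun I => tT I ∈ X)).card : ℝ) -
        (((intv n).filter (fun I => tS I ∈ X)).card : ℝ) := by
  obtain ⟨tT, h1, h2⟩ := hR.top_T
  obtain ⟨tS, h3, h4⟩ := hR.top_S
  refine ⟨tT, tS, h1, h3, ?_⟩
  intro X
  unfold ptR
  rw [Finset.sum_sub_distrib, ← sum_fiber, ← sum_fiber]
  push_cast
  simp only [← h2, ← h4]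
  push_cast
  rfl

theorem ptR_mem {R : Rectangulation n} (hR : R.InorderLabeled) :
    (∑ i, ptR R i) = 0 ∧ ∀ X : Finset (Fin n), (∑ i ∈ X, ptR R i) ≤ (fWeak n X : ℝ) := by
  obtain ⟨tT, tS, h1, h2, h3⟩ := ptR_data hR
  constructor
  · rw [h3]; simp
  · intro X
    rw [h3]
    have e := fWeak_add X
    have a1 : ((intv n).filter (fun I => tT I ∈ X)).card ≤
        ((intv n).filter (fun I => ¬ I ⊆ Xᶜ)).card := by
      apply Finset.card_le_card
      intro I hI
      simp only [Finset.mem_filter, mem_intv] at hI ⊢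
      refine ⟨hI.1, fun h => ?_⟩
      exact Finset.mem_compl.1 (h (h1 I hI.1).1) hI.2
    have a2 : ((intv n).filter (fun I => I ⊆ X)).card ≤
        ((intv n).filter (fun I => tS I ∈ X)).card := by
      apply Finset.card_le_card
      intro I hI
      simp only [Finset.mem_filter, mem_intv] at hI ⊢
      exact ⟨hI.1, hI.2 (h2 I hI.1).1⟩
    have : ((intv n).filter (fun I => tT I ∈ X)).card ≤
        fWeak n X + ((intv n).filter (fun I => tS I ∈ X)).card := by omega
    have : (((intv n).filter (fun I => tT I ∈ X)).card : ℝ) ≤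
        fWeak n X + ((intv n).filter (fun I => tS I ∈ X)).card := by exact_mod_cast this
    linarith

theorem ptR_eq {R : Rectangulation n} (hR : R.InorderLabeled) (σ : Equiv.Perm (Fin n))
    (hT : ∀ a b, R.TReach a b → σ a ≤ σ b) (hS : ∀ a b, R.SReach a b → σ a ≤ σ b)
    (X : Finset (Fin n)) (hX : ∀ a b, a ∈ X → σ a ≤ σ b → b ∈ X) :
    ∑ i ∈ X, ptR R i = (fWeak n X : ℝ) := by
  obtain ⟨tT, tS, h1, h2, h3⟩ := ptR_data hR
  rw [h3]
  have e := fWeak_add X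
  have a1 : (intv n).filter (fun I => tT I ∈ X) = (intv n).filter (fun I => ¬ I ⊆ Xᶜ) := by
    ext I
    simp only [Finset.mem_filter, mem_intv]
    refine and_congr_right (fun hI => ⟨fun h h' => ?_, fun h => ?_⟩)
    · exact Finset.mem_compl.1 (h' (h1 I hI).1) h
    · obtain ⟨a, ha, ha'⟩ := Finset.not_subset.1 h
      rw [Finset.mem_compl, not_not] at ha'
      exact hX a _ ha' (hT _ _ ((h1 I hI).2 a ha))
  have a2 : (intv n).filter (fun I => tS I ∈ X) = (intv n).filter (fun I => I ⊆ X) := by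
    ext I
    simp only [Finset.mem_filter, mem_intv]
    refine and_congr_right (fun hI => ⟨fun h a ha => ?_, fun h => h (h2 I hI).1⟩)
    exact hX _ a h (hS _ _ ((h2 I hI).2 a ha))
  rw [a1, a2, e]
  push_cast
  ring

theorem abel_ineq : ∀ (m : ℕ) (c d : Fin m → ℝ) (b : ℝ), Monotone c → (∀ i, b ≤ c i) →
    (∀ k : Fin m, 0 ≤ ∑ i ∈ Finset.Ici k, d i) → b * ∑ i, d i ≤ ∑ i, c i * d i := by
  intro m
  induction m with
  | zero => intro c d b _ _ _; simp
  | succ m ih =>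
    intro c d b hc hb hd
    have h := ih (fun i => c i.succ) (fun i => d i.succ) (c 0)
      (fun i j hij => hc (Fin.succ_le_succ_iff.2 hij)) (fun i => hc (Fin.zero_le _)) (by
        intro k
        have := hd k.succ
        have e : Finset.Ici k.succ = (Finset.Ici k).map (Fin.succEmb m) := by
          ext i
          simp only [Finset.mem_Ici, Finset.mem_map, Fin.coe_succEmb]
          constructor
          · intro h
            have hi : i ≠ 0 := fun h0 => by
              subst h0
              exact absurd h (not_le.2 (Fin.succ_pos k))
            obtain ⟨j, rfl⟩ := Fin.exists_succ_eq.2 hi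
            exact ⟨j, Fin.succ_le_succ_iff.1 h, rfl⟩
          · rintro ⟨j, hj, rfl⟩
            exact Fin.succ_le_succ_iff.2 hj
        rw [e, Finset.sum_map] at this
        simpa using this)
    have h0 := hd 0
    have e : Finset.Ici (0 : Fin (m + 1)) = Finset.univ := by ext; simp
    rw [e] at h0
    have hb0 := hb 0
    rw [Fin.sum_univ_succ] at h0 ⊢
    rw [Fin.sum_univ_succ]
    nlinarith

theorem rect_dominates (hn : 0 < n) (x : Fin n → ℝ) (h0 : ∑ i, x i = 0)
    (hx : ∀ X : Finset (Fin n), X.Nonempty → X ≠ Finset.univ →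
      (∑ i ∈ X, x i) ≤ (fWeak n X : ℝ)) (c : Fin n → ℝ) (pt : Equiv.Perm (Fin n) → Rectangulation n)
    (hpt : ∀ σ, (pt σ).InorderLabeled ∧
      (∀ a b, (pt σ).TReach a b → σ a ≤ σ b) ∧ (∀ a b, (pt σ).SReach a b → σ a ≤ σ b)) :
    ∃ σ, ∑ i, c i * x i ≤ ∑ i, c i * ptR (pt σ) i := by
  set τ := Tuple.sort c with hτ
  have hmono : Monotone (c ∘ τ) := Tuple.monotone_sort c
  refine ⟨τ⁻¹, ?_⟩
  obtain ⟨hR, hT, hS⟩ := hpt τ⁻¹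
  set R := pt τ⁻¹
  have hsum := (ptR_mem hR).1
  have key := abel_ineq n (c ∘ τ) (fun i => ptR R (τ i) - x (τ i)) ((c ∘ τ) ⟨0, hn⟩) hmono
    (fun i => hmono (Fin.le_def.2 (Nat.zero_le _))) (by
      intro k
      have e : ∑ i ∈ Finset.Ici k, (ptR R (τ i) - x (τ i)) =
          ∑ i ∈ (Finset.Ici k).map τ.toEmbedding, (ptR R i - x i) := by
        rw [Finset.sum_map]; rfl
      rw [e]
      set X := (Finset.Ici k).map τ.toEmbedding with hXdef
      have hmem : ∀ a, a ∈ X ↔ k ≤ τ⁻¹ a := by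
        intro a
        simp only [hXdef, Finset.mem_map, Finset.mem_Ici, Equiv.coe_toEmbedding]
        constructor
        · rintro ⟨b, hb, rfl⟩
          simpa using hb
        · intro h
          exact ⟨τ⁻¹ a, h, by simp⟩
      rw [Finset.sum_sub_distrib, ptR_eq hR τ⁻¹ hT hS X (by
        intro a b ha hab
        rw [hmem] at ha ⊢
        exact ha.trans hab)]
      by_cases hu : X = Finset.univ
      · rw [hu, h0]; simp
      · have := hx X ⟨τ k, by rw [hmem]; simp⟩ hu
        linarith)
  have e1 : ∑ i, (ptR R (τ i) - x (τ i)) = 0 := by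
    rw [Equiv.sum_comp τ (fun i => ptR R i - x i), Finset.sum_sub_distrib, hsum, h0, sub_zero]
  have e2 : ∑ i, (c ∘ τ) i * (ptR R (τ i) - x (τ i)) = ∑ i, c i * (ptR R i - x i) :=
    Equiv.sum_comp τ (fun i => c i * (ptR R i - x i))
  rw [e1, e2, mul_zero] at key
  simp only [mul_sub, Finset.sum_sub_distrib] at key
  linarith

end Final

/-- Theorem: realization of the weak rectangulotope `WRP(n)`.
The convex hull of the points `Σ_i (h^T_i·v^T_i − h^S_i·v^S_i)·e_i`, over all
generic (inorder-labeled) rectangulations `R` of size `n`, coincides with the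
set of `x ∈ ℝ^n` with `Σ_i x_i = 0` and `Σ_{i ∈ X} x_i ≤ f_≍(X)` for every
nonempty proper subset `X ⊊ [n]`. -/
theorem weak_rectangulotope_realization (n : ℕ) (hn : 1 ≤ n) :
    convexHull ℝ {x : Fin n → ℝ |
        ∃ R : Rectangulation n, R.Generic ∧ R.InorderLabeled ∧
          x = fun i => ((R.hT i * R.vT i : ℕ) : ℝ) - ((R.hS i * R.vS i : ℕ) : ℝ)} =
      {x : Fin n → ℝ | (∑ i, x i) = 0 ∧
        ∀ X : Finset (Fin n), X.Nonempty → X ≠ Finset.univ →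
          (∑ i ∈ X, x i) ≤ (fWeak n X : ℝ)} := by
  apply Set.Subset.antisymm
  · apply convexHull_min
    · rintro x ⟨R, _, hR, rfl⟩
      exact ⟨(ptR_mem hR).1, fun X _ _ => (ptR_mem hR).2 X⟩
    · rintro x ⟨hx0, hx⟩ y ⟨hy0, hy⟩ a b ha hb hab
      have e : ∀ X : Finset (Fin n), ∑ i ∈ X, (a • x + b • y) i =
          a * ∑ i ∈ X, x i + b * ∑ i ∈ X, y i := by
        intro X
        simp only [Pi.add_apply, Pi.smul_apply, smul_eq_mul, Finset.sum_add_distrib,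
          Finset.mul_sum]
      refine ⟨by rw [e, hx0, hy0]; simp, ?_⟩
      intro X h1 h2
      rw [e]
      have g1 := mul_le_mul_of_nonneg_left (hx X h1 h2) ha
      have g2 := mul_le_mul_of_nonneg_left (hy X h1 h2) hb
      have g3 : a * (fWeak n X : ℝ) + b * (fWeak n X : ℝ) = fWeak n X := by
        rw [← add_mul, hab, one_mul]
      linarith
  · rintro x ⟨hx0, hx⟩
    choose pt hg hin hT hS using fun σ => exists_rect_of_perm n hn σ
    have hsub : Set.range (fun σ => ptR (pt σ)) ⊆ {x : Fin n → ℝ |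
        ∃ R : Rectangulation n, R.Generic ∧ R.InorderLabeled ∧
          x = fun i => ((R.hT i * R.vT i : ℕ) : ℝ) - ((R.hS i * R.vS i : ℕ) : ℝ)} := by
      rintro _ ⟨σ, rfl⟩
      exact ⟨pt σ, hg σ, hin σ, rfl⟩
    apply convexHull_mono hsub
    by_contra hnot
    have hfin : (Set.range (fun σ => ptR (pt σ))).Finite := Set.finite_range _
    obtain ⟨f, u, h1, h2⟩ := geometric_hahn_banach_closed_point
      (convex_convexHull ℝ (Set.range (fun σ => ptR (pt σ)))) (hfin.isCompact_convexHull ℝ).isClosed hnot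
    have hf : ∀ y : Fin n → ℝ, f y = ∑ i, f (Pi.single i 1) * y i := by
      intro y
      conv_lhs => rw [← Finset.univ_sum_single y]
      rw [map_sum]
      refine Finset.sum_congr rfl (fun i _ => ?_)
      have : (Pi.single i (y i) : Fin n → ℝ) = y i • Pi.single i (1 : ℝ) := by
        rw [← Pi.single_smul]; simp
      rw [this, map_smul, smul_eq_mul, mul_comm]
    obtain ⟨σ, hσ⟩ := rect_dominates hn x hx0 hx (fun i => f (Pi.single i 1)) pt
      (fun σ => ⟨hin σ, hT σ, hS σ⟩)
    rw [← hf, ← hf] at hσ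
    have := h1 _ (subset_convexHull ℝ _ ⟨σ, rfl⟩)
    linarith

end
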